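/- arXiv:2506.03544 — 2 statements merged into one kernel-verified Lean document; each statement's English description precedes it below -/
import Mathlib

section
/- Let l > 5 be an integer and let (F_1,…,F_{l−1}) be a really canonical C_{2l}-freeness witnessing (l−1)-sequence. Then there is an index i such that every graph in F_i is the complement of a disjoint union of stars and triangles, and for every j ≠ i every graph in F_j is complete or is the edgeless graph on two vertices. -/
open SimpleGraph Filter

/-- `G` contains no induced copy of `H`. -/
def IndFree {W V : Type*} (H : SimpleGraph W) (G : SimpleGraph V) : Prop :=
  ¬ Nonempty (H ↪g G)

/-- A class of finite graphs: a predicate on graphs over every finite vertex type. -/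
abbrev GraphClass : Type 1 := ∀ (V : Type) [Finite V], SimpleGraph V → Prop

/-- A class of finite graphs is hereditary if it is closed under isomorphism and
under taking induced subgraphs (equivalently, closed under induced-subgraph
embeddings). -/
def GraphClass.Hereditary (F : GraphClass) : Prop :=
  ∀ (V W : Type) [Finite V] [Finite W] (G : SimpleGraph V) (L : SimpleGraph W),
    Nonempty (L ↪g G) → F V G → F W L

/-- The class contains all complete graphs. -/
def GraphClass.ContainsAllCliques (F : GraphClass) : Prop :=
  ∀ (V : Type) [Finite V], F V ⊤

/-- The class contains all edgeless graphs. -/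
def GraphClass.ContainsAllStables (F : GraphClass) : Prop :=
  ∀ (V : Type) [Finite V], F V ⊥

/-- `(F 0, …, F (k-1))` is an `H`-freeness witnessing `k`-sequence: a sequence of
hereditary classes such that for every partition of `V(H)` into `k` parts some part
induces a graph outside the corresponding class. -/
def IsWitnessingSeq {VH : Type} [Finite VH] (H : SimpleGraph VH) (k : ℕ)
    (F : Fin k → GraphClass) : Prop :=
  (∀ i, (F i).Hereditary) ∧
  ∀ X : VH → Fin k, ∃ i, ¬ F i ↥{v | X v = i} (H.induce {v | X v = i})

/-- `F` is canonical for `H`: there is a set `J` of induced subgraphs of `H` such that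
`F` is exactly the class of graphs containing no induced copy of a member of `J`. -/
def IsCanonicalFor {VH : Type} [Finite VH] (H : SimpleGraph VH) (F : GraphClass) : Prop :=
  ∃ J : GraphClass,
    (∀ (W : Type) [Finite W] (L : SimpleGraph W), J W L → Nonempty (L ↪g H)) ∧
    ∀ (V : Type) [Finite V] (G : SimpleGraph V),
      F V G ↔ ∀ (W : Type) [Finite W] (L : SimpleGraph W), J W L → IndFree L G

/-- A really canonical `H`-freeness witnessing `k`-sequence: a witnessing sequence in
which each class is canonical and contains all cliques or all stable sets. -/
def IsReallyCanonicalSeq {VH : Type} [Finite VH] (H : SimpleGraph VH) (k : ℕ)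
    (F : Fin k → GraphClass) : Prop :=
  IsWitnessingSeq H k F ∧
  ∀ i, IsCanonicalFor H (F i) ∧
    ((F i).ContainsAllCliques ∨ (F i).ContainsAllStables)

/-- `V(H)` can be partitioned into `c` cliques and `s` stable sets. -/
def HasCSPartition {VH : Type} (H : SimpleGraph VH) (c s : ℕ) : Prop :=
  ∃ f : VH → (Fin c ⊕ Fin s),
    (∀ i : Fin c, H.IsClique {v | f v = Sum.inl i}) ∧
    (∀ j : Fin s, ∀ a, f a = Sum.inr j → ∀ b, f b = Sum.inr j → ¬ H.Adj a b)

/-- `r` is the witnessing partition number of `H`: the greatest `m` such that for some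
`c + s = m` there is no partition of `V(H)` into `c` cliques and `s` stable sets. -/
def IsWpn {VH : Type} (H : SimpleGraph VH) (r : ℕ) : Prop :=
  IsGreatest {m | ∃ c s : ℕ, c + s = m ∧ ¬ HasCSPartition H c s} r

/-- `H` is a star: some center vertex is adjacent to all other vertices, and there
are no further edges.  One- and two-vertex stars are allowed. -/
def IsStarGraph {V : Type*} (H : SimpleGraph V) : Prop :=
  ∃ c : V, ∀ a b : V, H.Adj a b ↔ a ≠ b ∧ (a = c ∨ b = c)

/-- `H` is a triangle `K₃`. -/
def IsTriangleGraph {V : Type*} (H : SimpleGraph V) : Prop :=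
  Nonempty (H ≃g (⊤ : SimpleGraph (Fin 3)))

/-- Every connected component of `H` is a star or a triangle. -/
def StarsAndTriangles {V : Type*} (H : SimpleGraph V) : Prop :=
  ∀ c : H.ConnectedComponent,
    IsStarGraph (H.induce c.supp) ∨ IsTriangleGraph (H.induce c.supp)

/-- The class `K` contains a graph that can be placed on the positions satisfying `P`,
with adjacency given by consecutive positions. -/
def Good (K : GraphClass) (P : ℕ → Prop) : Prop :=
  ∃ (V : Type) (_ : Finite V) (G : SimpleGraph V), K V G ∧
    ∃ (n : ℕ) (q : Fin n → ℕ) (p : Fin n → V), Function.Injective p ∧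
      (∀ v, P v → ∃ k, q k = v) ∧
      ∀ k k', k < k' → (G.Adj (p k) (p k') ↔ (q k + 1 = q k' ∨ q k' + 1 = q k))

theorem good_pair {K : GraphClass} (hK : K.ContainsAllCliques) (a : ℕ) (P : ℕ → Prop)
    (hP : ∀ v, P v → v = a ∨ v = a + 1) : Good K P := by
  refine ⟨Fin 2, inferInstance, ⊤, hK _, 2, ![a, a + 1], id, Function.injective_id, ?_, ?_⟩
  · intro v hv
    rcases hP v hv with h | h
    · exact ⟨0, by simp [h]⟩
    · exact ⟨1, by simp [h]⟩
  · intro k k' h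
    fin_cases k <;> fin_cases k' <;> simp at h ⊢

/-- The colour of a position. -/
def colr (c : List ℕ) (v : ℕ) : ℕ := if v < 10 then c.getD v 0 else v / 2 - 1

theorem cyc_adj (N : ℕ) (v w : Fin N) (h : (v : ℕ) + 1 < N + w) (h' : (w : ℕ) + 1 < N + v) :
    (cycleGraph N).Adj v w ↔ ((v : ℕ) + 1 = w ∨ (w : ℕ) + 1 = v) := by
  rw [cycleGraph_adj', Fin.sub_def, Fin.sub_def]
  have hv := v.2
  have hw := w.2
  simp only
  rcases lt_trichotomy (v : ℕ) w with h1 | h1 | h1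
  · rw [Nat.mod_eq_of_lt (by omega : N - (w : ℕ) + v < N)]
    rw [show N - (v : ℕ) + w = (w - v) + N by omega, Nat.add_mod_right,
      Nat.mod_eq_of_lt (by omega)]
    omega
  · rw [show N - (v : ℕ) + w = N by omega, show N - (w : ℕ) + v = N by omega, Nat.mod_self]
    omega
  · rw [Nat.mod_eq_of_lt (by omega : N - (v : ℕ) + w < N)]
    rw [show N - (w : ℕ) + v = (v - w) + N by omega, Nat.add_mod_right,
      Nat.mod_eq_of_lt (by omega)]
    omega

theorem core (l : ℕ) (hl : 5 < l) (F : Fin (l - 1) → GraphClass)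
    (hF : IsWitnessingSeq (cycleGraph (2 * l)) (l - 1) F)
    (e : Fin (l - 1) ≃ Fin (l - 1)) (c : List ℕ) (hc : ∀ v < 10, c.getD v 0 < 4)
    (hg : ∀ m : Fin (l - 1), (m : ℕ) < 4 → Good (F (e m)) (fun v => v < 10 ∧ c.getD v 0 = m))
    (hcl : ∀ m : Fin (l - 1), 4 ≤ (m : ℕ) → (F (e m)).ContainsAllCliques) : False := by
  have hlt : ∀ v : Fin (2 * l), colr c v < l - 1 := by
    intro v
    have := v.2
    unfold colr
    split_ifs with h
    · have := hc v h; omega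
    · omega
  obtain ⟨i, hi⟩ := hF.2 (fun v => e ⟨colr c v, hlt v⟩)
  apply hi
  obtain ⟨m, rfl⟩ := e.surjective i
  have hgood : Good (F (e m)) (fun v => v < 2 * l ∧ colr c v = m) := by
    by_cases hm : (m : ℕ) < 4
    · obtain ⟨V, fV, G, hG, n, q, p, hp, hq, ha⟩ := hg m hm
      refine ⟨V, fV, G, hG, n, q, p, hp, ?_, ha⟩
      rintro v ⟨hv, hv'⟩
      unfold colr at hv'
      apply hq
      split_ifs at hv' with h
      · exact ⟨h, hv'⟩
      · omega
    · apply good_pair (hcl m (by omega)) (2 * m + 2)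
      rintro v ⟨hv, hv'⟩
      unfold colr at hv'
      split_ifs at hv' with h
      · have := hc v h; omega
      · omega
  obtain ⟨V, fV, G, hG, n, q, p, hp, hq, ha⟩ := hgood
  refine hF.1 (e m) V _ G _ ?_ hG
  have hcol : ∀ v : ↥{v : Fin (2 * l) | e ⟨colr c v, hlt v⟩ = e m}, colr c v.1 = m := by
    intro v
    have := v.2
    simp only [Set.mem_ofPred_eq, EmbeddingLike.apply_eq_iff_eq] at this
    exact congrArg Fin.val this
  have hk : ∀ v : ↥{v : Fin (2 * l) | e ⟨colr c v, hlt v⟩ = e m}, ∃ k, q k = v.1 := by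
    intro v
    exact hq _ ⟨v.1.2, hcol v⟩
  choose k hk using hk
  have kinj : Function.Injective k := by
    intro v w h
    have h1 := hk v
    rw [h, hk w] at h1
    exact Subtype.ext (Fin.ext h1.symm)
  refine ⟨⟨⟨fun v => p (k v), hp.comp kinj⟩, ?_⟩⟩
  intro v w
  simp only [Function.Embedding.coeFn_mk, comap_adj, Function.Embedding.subtype_apply]
  have hv := hcol v
  have hw := hcol w
  have hv2 := v.1.2
  have hw2 := w.1.2
  have hcv := hc v.1
  have hcw := hc w.1
  have hb : (v.1 : ℕ) + 1 < 2 * l + w.1 ∧ (w.1 : ℕ) + 1 < 2 * l + v.1 := by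
    unfold colr at hv hw
    split_ifs at hv hw <;> omega
  rw [cyc_adj _ _ _ hb.1 hb.2, ← hk v, ← hk w]
  rcases lt_trichotomy (k v) (k w) with h | h | h
  · exact ha _ _ h
  · rw [h]; simp
  · rw [G.adj_comm, ha _ _ h, or_comm]

theorem exists_perm1 (l : ℕ) (hl : 5 < l) (i : Fin (l - 1)) :
    ∃ e : Fin (l - 1) ≃ Fin (l - 1), e ⟨0, by omega⟩ = i :=
  ⟨Equiv.swap ⟨0, by omega⟩ i, by simp⟩

theorem exists_perm2 (l : ℕ) (hl : 5 < l) (i j : Fin (l - 1)) (hij : i ≠ j) :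
    ∃ e : Fin (l - 1) ≃ Fin (l - 1), e ⟨0, by omega⟩ = i ∧ e ⟨1, by omega⟩ = j := by
  obtain ⟨s, hs⟩ := exists_perm1 l hl i
  refine ⟨(Equiv.swap ⟨1, by omega⟩ (s.symm j)).trans s, ?_, ?_⟩
  · rw [Equiv.trans_apply, Equiv.swap_apply_of_ne_of_ne, hs]
    · simp
    · intro h
      apply hij
      rw [← hs, h]; simp
  · simp

/-- Table lemma, one special class on four vertices. -/
theorem tab4 (l : ℕ) (hl : 5 < l) (F : Fin (l - 1) → GraphClass)
    (hF : IsWitnessingSeq (cycleGraph (2 * l)) (l - 1) F) (i : Fin (l - 1))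
    (hcl : ∀ j, j ≠ i → (F j).ContainsAllCliques)
    (c : List ℕ) (hc : ∀ v < 10, c.getD v 0 < 4) (a1 a2 a3 : ℕ)
    (h1 : ∀ v < 10, c.getD v 0 = 1 → v = a1 ∨ v = a1 + 1)
    (h2 : ∀ v < 10, c.getD v 0 = 2 → v = a2 ∨ v = a2 + 1)
    (h3 : ∀ v < 10, c.getD v 0 = 3 → v = a3 ∨ v = a3 + 1)
    (h0 : Good (F i) (fun v => v < 10 ∧ c.getD v 0 = 0)) : False := by
  obtain ⟨e, he⟩ := exists_perm1 l hl i
  have hne : ∀ m : Fin (l - 1), (m : ℕ) ≠ 0 → (F (e m)).ContainsAllCliques := by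
    intro m hm
    apply hcl
    rw [← he]
    intro h
    exact hm (congrArg Fin.val (e.injective h))
  refine core l hl F hF e c hc ?_ (fun m hm => hne m (by omega))
  rintro ⟨m, hm⟩ hm4
  simp only at hm4 ⊢
  have h4 : m = 0 ∨ m = 1 ∨ m = 2 ∨ m = 3 := by omega
  rcases h4 with rfl | rfl | rfl | rfl
  · rw [he]; exact h0
  · exact good_pair (hne _ (by simp)) a1 _ (fun v hv => h1 v hv.1 hv.2)
  · exact good_pair (hne _ (by simp)) a2 _ (fun v hv => h2 v hv.1 hv.2)
  · exact good_pair (hne _ (by simp)) a3 _ (fun v hv => h3 v hv.1 hv.2)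

/-- Table lemma, two special classes. -/
theorem tab33 (l : ℕ) (hl : 5 < l) (F : Fin (l - 1) → GraphClass)
    (hF : IsWitnessingSeq (cycleGraph (2 * l)) (l - 1) F) (i j : Fin (l - 1)) (hij : i ≠ j)
    (hcl : ∀ j, (F j).ContainsAllCliques)
    (c : List ℕ) (hc : ∀ v < 10, c.getD v 0 < 4) (a2 a3 : ℕ)
    (h2 : ∀ v < 10, c.getD v 0 = 2 → v = a2 ∨ v = a2 + 1)
    (h3 : ∀ v < 10, c.getD v 0 = 3 → v = a3 ∨ v = a3 + 1)
    (h0 : Good (F i) (fun v => v < 10 ∧ c.getD v 0 = 0))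
    (h1 : Good (F j) (fun v => v < 10 ∧ c.getD v 0 = 1)) : False := by
  obtain ⟨e, he, he'⟩ := exists_perm2 l hl i j hij
  refine core l hl F hF e c hc ?_ (fun m hm => hcl _)
  rintro ⟨m, hm⟩ hm4
  simp only at hm4 ⊢
  have h4 : m = 0 ∨ m = 1 ∨ m = 2 ∨ m = 3 := by omega
  rcases h4 with rfl | rfl | rfl | rfl
  · rw [he]; exact h0
  · rw [he']; exact h1
  · exact good_pair (hcl _) a2 _ (fun v hv => h2 v hv.1 hv.2)
  · exact good_pair (hcl _) a3 _ (fun v hv => h3 v hv.1 hv.2)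

theorem good4 {K : GraphClass} {V : Type} [Finite V] {G : SimpleGraph V} (hG : K V G)
    {x y z t : V} (hxy : x ≠ y) (hxz : x ≠ z) (hxt : x ≠ t) (hyz : y ≠ z) (hyt : y ≠ t)
    (hzt : z ≠ t) (a b c d : ℕ) (P : ℕ → Prop)
    (hP : ∀ v, P v → v = a ∨ v = b ∨ v = c ∨ v = d)
    (e1 : G.Adj x y ↔ (a + 1 = b ∨ b + 1 = a)) (e2 : G.Adj x z ↔ (a + 1 = c ∨ c + 1 = a))
    (e3 : G.Adj x t ↔ (a + 1 = d ∨ d + 1 = a)) (e4 : G.Adj y z ↔ (b + 1 = c ∨ c + 1 = b))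
    (e5 : G.Adj y t ↔ (b + 1 = d ∨ d + 1 = b)) (e6 : G.Adj z t ↔ (c + 1 = d ∨ d + 1 = c)) :
    Good K P := by
  refine ⟨V, inferInstance, G, hG, 4, ![a, b, c, d], ![x, y, z, t], ?_, ?_, ?_⟩
  · intro k k' h
    fin_cases k <;> fin_cases k' <;> simp_all
  · intro v hv
    rcases hP v hv with h | h | h | h
    · exact ⟨0, by simp [h]⟩
    · exact ⟨1, by simp [h]⟩
    · exact ⟨2, by simp [h]⟩
    · exact ⟨3, by simp [h]⟩
  · intro k k' h
    fin_cases k <;> fin_cases k' <;> first | (exact absurd h (by decide)) | simpa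

theorem good3 {K : GraphClass} {V : Type} [Finite V] {G : SimpleGraph V} (hG : K V G)
    {x y z : V} (hxy : x ≠ y) (hxz : x ≠ z) (hyz : y ≠ z) (a b c : ℕ) (P : ℕ → Prop)
    (hP : ∀ v, P v → v = a ∨ v = b ∨ v = c)
    (e1 : G.Adj x y ↔ (a + 1 = b ∨ b + 1 = a)) (e2 : G.Adj x z ↔ (a + 1 = c ∨ c + 1 = a))
    (e4 : G.Adj y z ↔ (b + 1 = c ∨ c + 1 = b)) :
    Good K P := by
  refine ⟨V, inferInstance, G, hG, 3, ![a, b, c], ![x, y, z], ?_, ?_, ?_⟩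
  · intro k k' h
    fin_cases k <;> fin_cases k' <;> simp_all
  · intro v hv
    rcases hP v hv with h | h | h
    · exact ⟨0, by simp [h]⟩
    · exact ⟨1, by simp [h]⟩
    · exact ⟨2, by simp [h]⟩
  · intro k k' h
    fin_cases k <;> fin_cases k' <;> first | (exact absurd h (by decide)) | simpa

/-- No class contains a graph whose complement has a path on four vertices. -/
theorem no_path (l : ℕ) (hl : 5 < l) (F : Fin (l - 1) → GraphClass)
    (hF : IsWitnessingSeq (cycleGraph (2 * l)) (l - 1) F) (i : Fin (l - 1))
    (hcl : ∀ j, j ≠ i → (F j).ContainsAllCliques)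
    {V : Type} [Finite V] {G : SimpleGraph V} (hG : F i V G) {a b c d : V}
    (hab : a ≠ b) (hac : a ≠ c) (had : a ≠ d) (hbc : b ≠ c) (hbd : b ≠ d) (hcd : c ≠ d)
    (nab : ¬ G.Adj a b) (nbc : ¬ G.Adj b c) (ncd : ¬ G.Adj c d) : False := by
  -- the five possible shapes
  have s0 : ∀ x y z t : V, x ≠ y → x ≠ z → x ≠ t → y ≠ z → y ≠ t → z ≠ t →
      ¬ G.Adj x y → ¬ G.Adj x z → ¬ G.Adj x t → ¬ G.Adj y z → ¬ G.Adj y t → ¬ G.Adj z t →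
      False := by
    intro x y z t d1 d2 d3 d4 d5 d6 e1 e2 e3 e4 e5 e6
    refine tab4 l hl F hF i hcl [0, 1, 1, 0, 2, 2, 0, 3, 3, 0] (by decide) 1 4 7
      (by decide) (by decide) (by decide) (good4 hG d1 d2 d3 d4 d5 d6 0 3 6 9 _ ?_
        (by simpa) (by simpa) (by simpa) (by simpa) (by simpa) (by simpa))
    rintro v ⟨hv, h⟩
    revert h
    revert v
    decide
  have s1 : ∀ x y z t : V, x ≠ y → x ≠ z → x ≠ t → y ≠ z → y ≠ t → z ≠ t →
      G.Adj x y → ¬ G.Adj x z → ¬ G.Adj x t → ¬ G.Adj y z → ¬ G.Adj y t → ¬ G.Adj z t →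
      False := by
    intro x y z t d1 d2 d3 d4 d5 d6 e1 e2 e3 e4 e5 e6
    refine tab4 l hl F hF i hcl [0, 0, 1, 1, 0, 2, 2, 0, 3, 3] (by decide) 2 5 8
      (by decide) (by decide) (by decide) (good4 hG d1 d2 d3 d4 d5 d6 0 1 4 7 _ ?_
        (by simpa) (by simpa) (by simpa) (by simpa) (by simpa) (by simpa))
    rintro v ⟨hv, h⟩
    revert h
    revert v
    decide
  have s2 : ∀ x y z t : V, x ≠ y → x ≠ z → x ≠ t → y ≠ z → y ≠ t → z ≠ t →
      G.Adj x y → ¬ G.Adj x z → ¬ G.Adj x t → ¬ G.Adj y z → ¬ G.Adj y t → G.Adj z t →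
      False := by
    intro x y z t d1 d2 d3 d4 d5 d6 e1 e2 e3 e4 e5 e6
    refine tab4 l hl F hF i hcl [0, 0, 1, 1, 0, 0, 2, 2, 3, 3] (by decide) 2 6 8
      (by decide) (by decide) (by decide) (good4 hG d1 d2 d3 d4 d5 d6 0 1 4 5 _ ?_
        (by simpa) (by simpa) (by simpa) (by simpa) (by simpa) (by simpa))
    rintro v ⟨hv, h⟩
    revert h
    revert v
    decide
  have s3 : ∀ x y z t : V, x ≠ y → x ≠ z → x ≠ t → y ≠ z → y ≠ t → z ≠ t →
      G.Adj x y → ¬ G.Adj x z → ¬ G.Adj x t → G.Adj y z → ¬ G.Adj y t → ¬ G.Adj z t →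
      False := by
    intro x y z t d1 d2 d3 d4 d5 d6 e1 e2 e3 e4 e5 e6
    refine tab4 l hl F hF i hcl [0, 0, 0, 1, 1, 0, 2, 2, 3, 3] (by decide) 3 6 8
      (by decide) (by decide) (by decide) (good4 hG d1 d2 d3 d4 d5 d6 0 1 2 5 _ ?_
        (by simpa) (by simpa) (by simpa) (by simpa) (by simpa) (by simpa))
    rintro v ⟨hv, h⟩
    revert h
    revert v
    decide
  have s4 : ∀ x y z t : V, x ≠ y → x ≠ z → x ≠ t → y ≠ z → y ≠ t → z ≠ t →
      G.Adj x y → ¬ G.Adj x z → ¬ G.Adj x t → G.Adj y z → ¬ G.Adj y t → G.Adj z t →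
      False := by
    intro x y z t d1 d2 d3 d4 d5 d6 e1 e2 e3 e4 e5 e6
    refine tab4 l hl F hF i hcl [0, 0, 0, 0, 1, 1, 2, 2, 3, 3] (by decide) 4 6 8
      (by decide) (by decide) (by decide) (good4 hG d1 d2 d3 d4 d5 d6 0 1 2 3 _ ?_
        (by simpa) (by simpa) (by simpa) (by simpa) (by simpa) (by simpa))
    rintro v ⟨hv, h⟩
    revert h
    revert v
    decide
  have nba : ¬ G.Adj b a := fun h => nab h.symm
  have ncb : ¬ G.Adj c b := fun h => nbc h.symm
  have ndc : ¬ G.Adj d c := fun h => ncd h.symm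
  have hda := had.symm
  have hdb := hbd.symm
  have hca := hac.symm
  by_cases e1 : G.Adj a c <;> by_cases e2 : G.Adj b d <;> by_cases e3 : G.Adj a d
  · exact s4 c a d b hac.symm hcd hbc.symm had hab hbd.symm e1.symm ncd ncb e3 nab e2.symm
  · exact s2 a c b d hac hab had hbc.symm hcd hbd e1 nab e3 ncb ncd e2
  · exact s3 c a d b hac.symm hcd hbc.symm had hab hbd.symm e1.symm ncd ncb e3 nab
      (fun h => e2 h.symm)
  · exact s1 a c b d hac hab had hbc.symm hcd hbd e1 nab e3 ncb ncd e2
  · exact s3 a d b c had hab hac hbd.symm hcd.symm hbc e3 nab e1 e2.symm ndc nbc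
  · exact s1 b d a c hbd hab.symm hbc had.symm hcd.symm hac e2 nba nbc
      (fun h => e3 h.symm) ndc e1
  · exact s1 a d b c had hab hac hbd.symm hcd.symm hbc e3 nab e1 (fun h => e2 h.symm) ndc nbc
  · exact s0 a b c d hab hac had hbc hbd hcd nab e1 e3 nbc e2 ncd

/-- The class contains a three-vertex induced pattern of type `t`:
`0` stable, `1` a single edge plus a vertex, `2` a path. -/
def Pat (K : GraphClass) (t : Fin 3) : Prop :=
  ∃ (V : Type) (_ : Finite V) (G : SimpleGraph V), K V G ∧ ∃ x y z : V,
    x ≠ y ∧ x ≠ z ∧ y ≠ z ∧ (G.Adj x y ↔ t ≠ 0) ∧ ¬ G.Adj x z ∧ (G.Adj y z ↔ t = 2)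

theorem pat_of_not {K : GraphClass} {V : Type} [Finite V] {G : SimpleGraph V} (hG : K V G)
    {x y z : V} (hxy : x ≠ y) (hxz : x ≠ z) (hyz : y ≠ z) (h : ¬ G.Adj x z) :
    ∃ t, Pat K t := by
  by_cases e1 : G.Adj x y <;> by_cases e2 : G.Adj y z
  · exact ⟨2, V, inferInstance, G, hG, x, y, z, hxy, hxz, hyz, by simpa, h, by simpa⟩
  · exact ⟨1, V, inferInstance, G, hG, x, y, z, hxy, hxz, hyz, by simpa, h, by simpa⟩
  · exact ⟨1, V, inferInstance, G, hG, z, y, x, hyz.symm, hxz.symm, hxy.symm,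
      by simpa using e2.symm, fun e => h e.symm, by simpa using fun e : G.Adj y x => e1 e.symm⟩
  · exact ⟨0, V, inferInstance, G, hG, x, y, z, hxy, hxz, hyz, by simpa, h, by simpa⟩

theorem pat_good {K : GraphClass} {t : Fin 3} (h : Pat K t) (a b c : ℕ) (P : ℕ → Prop)
    (hP : ∀ v, P v → v = a ∨ v = b ∨ v = c)
    (e1 : t ≠ 0 ↔ (a + 1 = b ∨ b + 1 = a)) (e2 : ¬ (a + 1 = c ∨ c + 1 = a))
    (e4 : t = 2 ↔ (b + 1 = c ∨ c + 1 = b)) : Good K P := by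
  obtain ⟨V, _, G, hG, x, y, z, h1, h2, h3, h4, h5, h6⟩ := h
  exact good3 hG h1 h2 h3 a b c P hP (h4.trans e1) (iff_of_false h5 e2) (h6.trans e4)

theorem no_two_le (l : ℕ) (hl : 5 < l) (F : Fin (l - 1) → GraphClass)
    (hF : IsWitnessingSeq (cycleGraph (2 * l)) (l - 1) F) (i j : Fin (l - 1)) (hij : i ≠ j)
    (hcl : ∀ j, (F j).ContainsAllCliques) (s t : Fin 3) (hst : t ≤ s)
    (hs : Pat (F i) s) (ht : Pat (F j) t) : False := by
  have key : ∀ (c : List ℕ) (_ : ∀ v < 10, c.getD v 0 < 4) (a2 a3 : ℕ)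
    (_ : ∀ v < 10, c.getD v 0 = 2 → v = a2 ∨ v = a2 + 1)
    (_ : ∀ v < 10, c.getD v 0 = 3 → v = a3 ∨ v = a3 + 1)
    (x y z x' y' z' : ℕ)
    (_ : ∀ v < 10, c.getD v 0 = 0 → v = x ∨ v = y ∨ v = z)
    (_ : ∀ v < 10, c.getD v 0 = 1 → v = x' ∨ v = y' ∨ v = z')
    (_ : s ≠ 0 ↔ (x + 1 = y ∨ y + 1 = x)) (_ : ¬ (x + 1 = z ∨ z + 1 = x))
    (_ : s = 2 ↔ (y + 1 = z ∨ z + 1 = y))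
    (_ : t ≠ 0 ↔ (x' + 1 = y' ∨ y' + 1 = x')) (_ : ¬ (x' + 1 = z' ∨ z' + 1 = x'))
    (_ : t = 2 ↔ (y' + 1 = z' ∨ z' + 1 = y')), False := by
    intro c hc a2 a3 h2 h3 x y z x' y' z' hx hx' p1 p2 p3 p4 p5 p6
    exact tab33 l hl F hF i j hij hcl c hc a2 a3 h2 h3
      (pat_good hs x y z _ (fun v hv => hx v hv.1 hv.2) p1 p2 p3)
      (pat_good ht x' y' z' _ (fun v hv => hx' v hv.1 hv.2) p4 p5 p6)
  clear hs ht
  have hcases : (s = 2 ∧ t = 2) ∨ (s = 2 ∧ t = 1) ∨ (s = 2 ∧ t = 0) ∨ (s = 1 ∧ t = 1) ∨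
      (s = 1 ∧ t = 0) ∨ (s = 0 ∧ t = 0) := by
    clear key
    revert s t
    decide
  rcases hcases with ⟨rfl, rfl⟩ | ⟨rfl, rfl⟩ | ⟨rfl, rfl⟩ | ⟨rfl, rfl⟩ | ⟨rfl, rfl⟩ | ⟨rfl, rfl⟩
  · exact key [0, 0, 0, 1, 1, 1, 2, 2, 3, 3] (by decide) 6 8 (by decide) (by decide)
      0 1 2 3 4 5 (by decide) (by decide) (by decide) (by decide) (by decide) (by decide)
      (by decide) (by decide)
  · exact key [0, 0, 0, 1, 2, 2, 1, 1, 3, 3] (by decide) 4 8 (by decide) (by decide)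
      0 1 2 6 7 3 (by decide) (by decide) (by decide) (by decide) (by decide) (by decide)
      (by decide) (by decide)
  · exact key [0, 0, 0, 1, 2, 2, 1, 3, 3, 1] (by decide) 4 7 (by decide) (by decide)
      0 1 2 3 6 9 (by decide) (by decide) (by decide) (by decide) (by decide) (by decide)
      (by decide) (by decide)
  · exact key [0, 0, 1, 0, 1, 1, 2, 2, 3, 3] (by decide) 6 8 (by decide) (by decide)
      0 1 3 4 5 2 (by decide) (by decide) (by decide) (by decide) (by decide) (by decide)
      (by decide) (by decide)
  · exact key [0, 0, 1, 0, 1, 2, 2, 1, 3, 3] (by decide) 5 8 (by decide) (by decide)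
      0 1 3 2 4 7 (by decide) (by decide) (by decide) (by decide) (by decide) (by decide)
      (by decide) (by decide)
  · exact key [0, 1, 0, 1, 0, 1, 2, 2, 3, 3] (by decide) 6 8 (by decide) (by decide)
      0 2 4 1 3 5 (by decide) (by decide) (by decide) (by decide) (by decide) (by decide)
      (by decide) (by decide)

theorem no_two (l : ℕ) (hl : 5 < l) (F : Fin (l - 1) → GraphClass)
    (hF : IsWitnessingSeq (cycleGraph (2 * l)) (l - 1) F) (i j : Fin (l - 1)) (hij : i ≠ j)
    (hcl : ∀ j, (F j).ContainsAllCliques) (s t : Fin 3)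
    (hs : Pat (F i) s) (ht : Pat (F j) t) : False := by
  rcases le_total t s with h | h
  · exact no_two_le l hl F hF i j hij hcl s t h hs ht
  · exact no_two_le l hl F hF j i hij.symm hcl t s h ht hs

theorem no_two_stable (l : ℕ) (hl : 5 < l) (F : Fin (l - 1) → GraphClass)
    (hF : IsReallyCanonicalSeq (cycleGraph (2 * l)) (l - 1) F) (i j : Fin (l - 1)) (hij : i ≠ j)
    (hi : (F i).ContainsAllStables) (hj : (F j).ContainsAllStables) : False := by
  obtain ⟨m, hm⟩ := hF.1.2 (fun v => if (v : ℕ) % 2 = 0 then i else j)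
  apply hm
  have hbot : (cycleGraph (2 * l)).induce
      {v : Fin (2 * l) | (if (v : ℕ) % 2 = 0 then i else j) = m} = ⊥ := by
    ext ⟨v, hv⟩ ⟨w, hw⟩
    simp only [comap_adj, Function.Embedding.subtype_apply, bot_adj, iff_false]
    intro h
    have hpar : (v : ℕ) % 2 = (w : ℕ) % 2 := by
      simp only [Set.mem_ofPred_eq] at hv hw
      split_ifs at hv hw with h1 h2 h2
      · omega
      · exact absurd (hv.trans hw.symm) hij
      · exact absurd (hw.trans hv.symm) hij
      · omega
    rw [cycleGraph_adj', Fin.sub_def, Fin.sub_def] at h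
    simp only at h
    have hv2 := v.2
    have hw2 := w.2
    have m1 := Nat.mod_mod_of_dvd (2 * l - (w : ℕ) + v) (Dvd.intro l rfl : 2 ∣ 2 * l)
    have m2 := Nat.mod_mod_of_dvd (2 * l - (v : ℕ) + w) (Dvd.intro l rfl : 2 ∣ 2 * l)
    rcases h with h | h
    · rw [h] at m1; omega
    · rw [h] at m2; omega
  rw [hbot]
  by_cases h1 : m = i
  · subst h1; exact hi _
  by_cases h2 : m = j
  · subst h2; exact hj _
  have hemp : IsEmpty ↥{v : Fin (2 * l) | (if (v : ℕ) % 2 = 0 then i else j) = m} := by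
    constructor
    rintro ⟨v, hv⟩
    simp only [Set.mem_ofPred_eq] at hv
    split_ifs at hv
    · exact h1 hv.symm
    · exact h2 hv.symm
  rcases (hF.2 m).2 with h | h
  · have := h ↥{v : Fin (2 * l) | (if (v : ℕ) % 2 = 0 then i else j) = m}
    rwa [Subsingleton.elim (⊤ : SimpleGraph
      ↥{v : Fin (2 * l) | (if (v : ℕ) % 2 = 0 then i else j) = m}) ⊥] at this
  · exact h _

theorem all_cliques (l : ℕ) (hl : 5 < l) (F : Fin (l - 1) → GraphClass)
    (hF : IsReallyCanonicalSeq (cycleGraph (2 * l)) (l - 1) F) (i : Fin (l - 1)) :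
    (F i).ContainsAllCliques := by
  rcases (hF.2 i).2 with h | h
  · exact h
  exfalso
  have hcl : ∀ j, j ≠ i → (F j).ContainsAllCliques := by
    intro j hj
    rcases (hF.2 j).2 with h' | h'
    · exact h'
    · exact (no_two_stable l hl F hF i j hj.symm h h').elim
  exact no_path l hl F hF.1 i hcl (h (Fin 4)) (a := 0) (b := 1) (c := 2) (d := 3)
    (by decide) (by decide) (by decide) (by decide) (by decide) (by decide)
    (by simp) (by simp) (by simp)

theorem stars_of_no_path {V : Type} (H : SimpleGraph V)
    (hH : ∀ a b c d : V, a ≠ c → a ≠ d → b ≠ d → H.Adj a b → H.Adj b c → H.Adj c d → False) :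
    StarsAndTriangles H := by
  intro C
  -- choose a centre
  obtain ⟨b, hbC, hb⟩ : ∃ b ∈ C.supp,
      ∀ n x, H.Adj b n → H.Adj n x → x = b ∨ H.Adj b x := by
    by_cases hex : ∃ b ∈ C.supp, ∃ a c, a ≠ c ∧ H.Adj b a ∧ H.Adj b c
    · obtain ⟨b, hbC, a, c, hac, hba, hbc⟩ := hex
      refine ⟨b, hbC, ?_⟩
      intro n x hn hx
      by_contra hcon
      push Not at hcon
      obtain ⟨hxb, hnx⟩ := hcon
      obtain ⟨n', hn', hbn'⟩ : ∃ n', n' ≠ n ∧ H.Adj b n' := by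
        by_cases h : a = n
        · exact ⟨c, fun h' => hac (h.trans h'.symm), hbc⟩
        · exact ⟨a, h, hba⟩
      exact hH n' b n x hn' (fun h => hnx (h ▸ hbn')) hxb.symm hbn'.symm hn hx
    · push Not at hex
      obtain ⟨b, hbC⟩ := C.nonempty_supp
      refine ⟨b, hbC, ?_⟩
      intro n x hn hx
      left
      by_contra hxb
      have hnC : n ∈ C.supp := C.mem_supp_of_adj_mem_supp hbC hn
      exact hex n hnC x b hxb hx hn.symm
  have hall : ∀ x ∈ C.supp, x = b ∨ H.Adj b x := by
    intro x hx
    have hr : H.Reachable b x := by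
      rw [ConnectedComponent.mem_supp_iff] at hx hbC
      exact ConnectedComponent.exact (hbC.trans hx.symm)
    rw [reachable_iff_reflTransGen] at hr
    induction hr with
    | refl => exact Or.inl rfl
    | @tail y z hy hyz ih =>
      have hyC : y ∈ C.supp := C.mem_supp_of_adj_mem_supp hx hyz.symm
      rcases ih hyC with rfl | h
      · exact Or.inr hyz
      · exact hb y z h hyz
  by_cases hedge : ∃ n n', H.Adj b n ∧ H.Adj b n' ∧ H.Adj n n'
  · right
    obtain ⟨n, n', hn, hn', hnn⟩ := hedge
    have hset : C.supp = {b, n, n'} := by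
      ext x
      constructor
      · intro hx
        rcases hall x hx with rfl | h
        · simp
        · by_contra hcon
          simp only [Set.mem_insert_iff, Set.mem_singleton_iff, not_or] at hcon
          exact hH x b n n' hcon.2.1 hcon.2.2 hn'.ne h.symm hn hnn
      · rintro (rfl | rfl | rfl)
        · exact hbC
        · exact C.mem_supp_of_adj_mem_supp hbC hn
        · exact C.mem_supp_of_adj_mem_supp hbC hn'
    have hcard : Nat.card C.supp = 3 := by
      rw [Nat.card_coe_set_eq, hset]
      exact Set.ncard_eq_three.mpr ⟨b, n, n', hn.ne, hn'.ne, hnn.ne, rfl⟩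
    have : Finite C.supp := Nat.finite_of_card_ne_zero (by omega)
    refine ⟨⟨(Finite.equivFinOfCardEq hcard), ?_⟩⟩
    rintro ⟨x, hx⟩ ⟨y, hy⟩
    simp only [top_adj, ne_eq, EmbeddingLike.apply_eq_iff_eq, comap_adj,
      Function.Embedding.subtype_apply, Subtype.mk.injEq]
    rw [hset] at hx hy
    have s1 := hn.symm
    have s2 := hn'.symm
    have s3 := hnn.symm
    constructor
    · intro hne
      rcases hx with rfl | rfl | rfl <;> rcases hy with rfl | rfl | rfl <;>
        first | assumption | exact absurd rfl hne
    · exact fun h => h.ne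
  · left
    push Not at hedge
    refine ⟨⟨b, hbC⟩, ?_⟩
    rintro ⟨x, hx⟩ ⟨y, hy⟩
    simp only [comap_adj, Function.Embedding.subtype_apply, ne_eq, Subtype.mk.injEq]
    constructor
    · intro h
      refine ⟨h.ne, ?_⟩
      rcases hall x hx with rfl | h1
      · exact Or.inl rfl
      · rcases hall y hy with rfl | h2
        · exact Or.inr rfl
        · exact absurd h (hedge x y h1 h2)
    · rintro ⟨hne, rfl | rfl⟩
      · rcases hall y hy with h | h
        · exact absurd h.symm hne
        · exact h
      · rcases hall x hx with h | h
        · exact absurd h hne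
        · exact h.symm

/-- For `l > 5`, every really canonical `C_{2l}`-freeness witnessing `(l-1)`-sequence
has an index `i` such that every graph in `F i` is the complement of a disjoint union
of stars and triangles, and for every `j ≠ i` every graph in `F j` is complete or the
edgeless graph on two vertices. -/
theorem stmt_9 (l : ℕ) (hl : 5 < l) (F : Fin (l - 1) → GraphClass)
    (hF : IsReallyCanonicalSeq (SimpleGraph.cycleGraph (2 * l)) (l - 1) F) :
    ∃ i : Fin (l - 1),
      (∀ (V : Type) [Finite V] (G : SimpleGraph V),
        F i V G → StarsAndTriangles Gᶜ) ∧
      (∀ j : Fin (l - 1), j ≠ i → ∀ (V : Type) [Finite V] (G : SimpleGraph V),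
        F j V G → G = ⊤ ∨ (Nat.card V = 2 ∧ G = ⊥)) := by
  have hcl := all_cliques l hl F hF
  have hfirst : ∀ (i : Fin (l - 1)) (V : Type) [Finite V] (G : SimpleGraph V),
      F i V G → StarsAndTriangles Gᶜ := by
    intro i V _ G hG
    apply stars_of_no_path
    intro a b c d hac had hbd hab hbc hcd
    rw [compl_adj] at hab hbc hcd
    exact no_path l hl F hF.1 i (fun j _ => hcl j) hG hab.1 hac had hbc.1 hbd hcd.1
      hab.2 hbc.2 hcd.2
  have hsecond : ∀ j : Fin (l - 1), (∀ t, ¬ Pat (F j) t) →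
      ∀ (V : Type) [Finite V] (G : SimpleGraph V),
        F j V G → G = ⊤ ∨ (Nat.card V = 2 ∧ G = ⊥) := by
    intro j hj V _ G hG
    by_cases htop : G = ⊤
    · exact Or.inl htop
    right
    obtain ⟨x, z, hxz, hn⟩ : ∃ x z, x ≠ z ∧ ¬ G.Adj x z := by
      by_contra hcon
      push Not at hcon
      apply htop
      ext x z
      rw [top_adj]
      exact ⟨fun h => h.ne, hcon x z⟩
    have hall : ∀ y, y = x ∨ y = z := by
      intro y
      by_contra hcon
      push Not at hcon
      obtain ⟨t, ht⟩ := pat_of_not hG hcon.1.symm hxz hcon.2 hn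
      exact hj t ht
    constructor
    · rw [Nat.card_eq_two_iff]
      refine ⟨x, z, hxz, ?_⟩
      ext y
      simpa using hall y
    · ext u v
      simp only [bot_adj, iff_false]
      intro h
      rcases hall u with rfl | rfl <;> rcases hall v with rfl | rfl
      · exact h.ne rfl
      · exact hn h
      · exact hn h.symm
      · exact h.ne rfl
  by_cases hex : ∃ i t, Pat (F i) t
  · obtain ⟨i, s, hs⟩ := hex
    refine ⟨i, hfirst i, fun j hj => hsecond j ?_⟩
    intro t ht
    exact no_two l hl F hF.1 i j hj.symm hcl s t hs ht
  · push Not at hex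
    exact ⟨⟨0, by omega⟩, hfirst _, fun j _ => hsecond j (hex j)⟩
end

section
/- For every integer l > 3 and every n ≥ 1, the number of C_{2l}-free graphs on vertex set {1,…,n} is at least 2^{(1 − 1/(l−1))·binom(n,2)} · B_{⌈n/(l−1)⌉}. -/
open SimpleGraph

/-- The Bell number: the number of partitions of `{1,…,n}`. -/
noncomputable def bellNum (n : ℕ) : ℕ :=
  Nat.card (Finpartition (Finset.univ : Finset (Fin n)))

lemma cyc_adj_s14 (k : ℕ) (hk : 8 ≤ k) (u v : Fin k) : (cycleGraph k).Adj u v ↔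
    (u.val + 1 = v.val ∨ v.val + 1 = u.val ∨ (u.val = 0 ∧ v.val + 1 = k) ∨ (v.val = 0 ∧ u.val + 1 = k)) := by
  rw [cycleGraph_adj']
  have hu := u.isLt
  have hv := v.isLt
  simp only [Fin.sub_def]
  rcases lt_trichotomy u.val v.val with h | h | h
  · rw [Nat.mod_eq_of_lt (by omega : k - v.val + u.val < k)]
    rw [show k - u.val + v.val = (v.val - u.val) + k by omega, Nat.add_mod_right, Nat.mod_eq_of_lt (by omega)]
    omega
  · rw [h, show k - v.val + v.val = k by omega, Nat.mod_self]
    omega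
  · rw [Nat.mod_eq_of_lt (by omega : k - u.val + v.val < k)]
    rw [show k - v.val + u.val = (u.val - v.val) + k by omega, Nat.add_mod_right, Nat.mod_eq_of_lt (by omega)]
    omega

lemma cyc_deg (k : ℕ) (hk : 8 ≤ k) (x a b c : Fin k) (hab : a ≠ b) (hac : a ≠ c) (hbc : b ≠ c) :
    ¬ ((cycleGraph k).Adj x a ∧ (cycleGraph k).Adj x b ∧ (cycleGraph k).Adj x c) := by
  simp only [cyc_adj_s14 k hk, ne_eq, Fin.ext_iff] at *
  omega

lemma cyc_tri (k : ℕ) (hk : 8 ≤ k) (a b c : Fin k) :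
    ¬ ((cycleGraph k).Adj a b ∧ (cycleGraph k).Adj b c ∧ (cycleGraph k).Adj a c) := by
  simp only [cyc_adj_s14 k hk]
  omega

lemma cyc_four (k : ℕ) (hk : 8 ≤ k) (a b c d : Fin k) (hac : a ≠ c) (hbd : b ≠ d) :
    ¬ ((cycleGraph k).Adj a b ∧ (cycleGraph k).Adj b c ∧ (cycleGraph k).Adj c d ∧
      (cycleGraph k).Adj d a) := by
  simp only [cyc_adj_s14 k hk, ne_eq, Fin.ext_iff] at *
  omega

lemma key (k : ℕ) (hk : 8 ≤ k) (f : ℕ → ℕ) (hf : ∀ x, f (f x) = f x) (φ : Fin k → ℕ)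
    (S : Finset (Fin k)) (hφ : ∀ x ∈ S, ∀ y ∈ S, φ x = φ y → x = y)
    (h : ∀ x ∈ S, ∀ y ∈ S, x ≠ y → ((cycleGraph k).Adj x y ↔ f (φ x) ≠ φ y ∧ f (φ y) ≠ φ x)) :
    S.card ≤ 3 := by
  by_contra! hS
  obtain ⟨T, hT, hc⟩ := Finset.exists_subset_card_eq (show 4 ≤ S.card by omega)
  obtain ⟨a, b, c, d, hab, hac, had, hbc, hbd, hcd, rfl⟩ := Finset.card_eq_four.1 hc
  have ha : a ∈ S := hT (by simp)
  have hb : b ∈ S := hT (by simp)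
  have hc' : c ∈ S := hT (by simp)
  have hd : d ∈ S := hT (by simp)
  have pab := fun e => hab (hφ a ha b hb e)
  have pac := fun e => hac (hφ a ha c hc' e)
  have pad := fun e => had (hφ a ha d hd e)
  have pbc := fun e => hbc (hφ b hb c hc' e)
  have pbd := fun e => hbd (hφ b hb d hd e)
  have pcd := fun e => hcd (hφ c hc' d hd e)
  have qab := h a ha b hb hab
  have qac := h a ha c hc' hac
  have qad := h a ha d hd had
  have qbc := h b hb c hc' hbc
  have qbd := h b hb d hd hbd
  have qcd := h c hc' d hd hcd
  have da := cyc_deg k hk a b c d hbc hbd hcd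
  have db := cyc_deg k hk b a c d hac had hcd
  have dc := cyc_deg k hk c a b d hab had hbd
  have dd := cyc_deg k hk d a b c hab hac hbc
  have t1 := cyc_tri k hk a b c
  have t2 := cyc_tri k hk a b d
  have t3 := cyc_tri k hk a c d
  have t4 := cyc_tri k hk b c d
  have f1 := cyc_four k hk a b c d hac hbd
  have f2 := cyc_four k hk a b d c had hbc
  have f3 := cyc_four k hk a c b d hab hcd
  have ia := hf (φ a)
  have ib := hf (φ b)
  have ic := hf (φ c)
  have id := hf (φ d)
  rw [(cycleGraph k).adj_comm b a] at db
  rw [(cycleGraph k).adj_comm c a, (cycleGraph k).adj_comm c b] at dc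
  rw [(cycleGraph k).adj_comm d a, (cycleGraph k).adj_comm d b, (cycleGraph k).adj_comm d c] at dd
  rw [(cycleGraph k).adj_comm d a] at f1 f3
  rw [(cycleGraph k).adj_comm d c, (cycleGraph k).adj_comm c a] at f2
  rw [(cycleGraph k).adj_comm c b] at f3
  rw [qab, qac, qad] at da
  rw [qab, qbc, qbd] at db
  rw [qac, qbc, qcd] at dc
  rw [qad, qbd, qcd] at dd
  rw [qab, qbc, qac] at t1
  rw [qab, qbd, qad] at t2
  rw [qac, qcd, qad] at t3
  rw [qbc, qcd, qbd] at t4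
  rw [qab, qbc, qcd, qad] at f1
  rw [qab, qbd, qcd, qac] at f2
  rw [qac, qbc, qbd, qad] at f3
  clear qab qac qad qbc qbd qcd h hφ hf
  generalize φ a = a at *
  generalize φ b = b at *
  generalize φ c = c at *
  generalize φ d = d at *
  clear hab hac had hbc hbd hcd hT hc ha hb hc' hd hS
  grind (splits := 60)

/-- Two naturals lie in the same part of `P`. -/
def sameP {q : ℕ} (P : Finpartition (Finset.univ : Finset (Fin q))) (x y : ℕ) : Prop :=
  x = y ∨ ∃ (hx : x < q) (hy : y < q), P.part ⟨x, hx⟩ = P.part ⟨y, hy⟩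

/-- Least element in the part. -/
noncomputable def starFn {q : ℕ} (P : Finpartition (Finset.univ : Finset (Fin q))) (x : ℕ) : ℕ :=
  sInf {y | sameP P x y}

section
variable {q : ℕ} (P : Finpartition (Finset.univ : Finset (Fin q)))

lemma sameP_symm {x y : ℕ} (h : sameP P x y) : sameP P y x := by
  rcases h with h | ⟨hx, hy, h⟩
  · exact Or.inl h.symm
  · exact Or.inr ⟨hy, hx, h.symm⟩

lemma sameP_trans {x y z : ℕ} (h : sameP P x y) (h' : sameP P y z) : sameP P x z := by
  rcases h with rfl | ⟨hx, hy, h⟩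
  · exact h'
  · rcases h' with rfl | ⟨hy', hz, h'⟩
    · exact Or.inr ⟨hx, hy, h⟩
    · exact Or.inr ⟨hx, hz, h.trans h'⟩

lemma starFn_mem (x : ℕ) : sameP P x (starFn P x) :=
  Nat.sInf_mem (s := {y | sameP P x y}) ⟨x, Or.inl rfl⟩

lemma starFn_le (x : ℕ) : starFn P x ≤ x :=
  Nat.sInf_le (s := {y | sameP P x y}) (Or.inl rfl)

lemma starFn_eq_iff (x y : ℕ) : starFn P x = starFn P y ↔ sameP P x y := by
  constructor
  · intro h
    have h1 := starFn_mem P x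
    rw [h] at h1
    exact sameP_trans P h1 (sameP_symm P (starFn_mem P y))
  · intro h
    unfold starFn
    congr 1
    ext z
    exact ⟨fun hz => sameP_trans P (sameP_symm P h) hz, fun hz => sameP_trans P h hz⟩

lemma starFn_idem (x : ℕ) : starFn P (starFn P x) = starFn P x :=
  (starFn_eq_iff P _ _).2 (sameP_symm P (starFn_mem P x))

end

lemma starFn_inj {q : ℕ} (P Q : Finpartition (Finset.univ : Finset (Fin q)))
    (h : ∀ x < q, starFn P x = starFn Q x) : P = Q := by
  have key : ∀ x y : Fin q, P.part x = P.part y ↔ Q.part x = Q.part y := by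
    have aux : ∀ (R : Finpartition (Finset.univ : Finset (Fin q))) (x y : Fin q),
        R.part x = R.part y ↔ starFn R x = starFn R y := by
      intro R x y
      rw [starFn_eq_iff]
      constructor
      · intro h
        exact Or.inr ⟨x.2, y.2, h⟩
      · rintro (h | ⟨_, _, h⟩)
        · rw [Fin.ext h]
        · exact h
    intro x y
    rw [aux, aux, h x x.2, h y y.2]
  have hpart : ∀ x, P.part x = Q.part x := by
    intro x
    ext y
    rw [P.mem_part_iff_part_eq_part (by simp) (by simp),
      Q.mem_part_iff_part_eq_part (by simp) (by simp)]
    exact key _ _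
  have hparts : ∀ (R : Finpartition (Finset.univ : Finset (Fin q))) (t : Finset (Fin q)),
      t ∈ R.parts ↔ ∃ x, R.part x = t := by
    intro R t
    constructor
    · intro ht
      obtain ⟨x, hx⟩ := R.nonempty_of_mem_parts ht
      exact ⟨x, R.part_eq_of_mem ht hx⟩
    · rintro ⟨x, rfl⟩
      exact R.part_mem.2 (by simp)
  ext t
  rw [hparts, hparts]
  simp [hpart]

/-- The freely choosable pairs. -/
def pairsD (n m : ℕ) : Finset (Σ _ : ℕ, ℕ) :=
  (Finset.range n).sigma fun j => (Finset.range j).filter fun i => ¬ i % m = j % m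

lemma card_pairsD (n m : ℕ) (hm : 0 < m) :
    (1 - 1 / (m : ℝ)) * (n.choose 2 : ℝ) ≤ ((pairsD n m).card : ℝ) := by
  have h1 : ∀ j : ℕ, (1 - 1 / (m : ℝ)) * (j : ℝ) ≤
      (((Finset.range j).filter fun i => ¬ i % m = j % m).card : ℝ) := by
    intro j
    have h2 := Finset.card_filter_add_card_filter_not (s := Finset.range j) (fun i => i % m = j % m)
    have h3 := Nat.count_modEq_card j hm j
    rw [Nat.count_eq_card_filter_range] at h3
    simp only [Nat.ModEq, lt_irrefl, if_false, add_zero] at h3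
    have h3' : ((Finset.range j).filter fun i => i % m = j % m).card = j / m := by
      rw [← h3]
      congr 1
    rw [h3', Finset.card_range] at h2
    have h4 : ((j / m : ℕ) : ℝ) ≤ (j : ℝ) / m := Nat.cast_div_le
    have h5 : ((j / m : ℕ) : ℝ) + (((Finset.range j).filter fun i => ¬ i % m = j % m).card : ℝ)
        = (j : ℝ) := by exact_mod_cast h2
    have h6 : (1 - 1 / (m : ℝ)) * (j : ℝ) = j - (j : ℝ) / m := by ring
    linarith
  rw [pairsD, Finset.card_sigma, Nat.choose_two_right, ← Finset.sum_range_id]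
  push_cast
  rw [Finset.mul_sum]
  exact Finset.sum_le_sum fun j _ => h1 j

/-- The constructed graph. -/
def conG (n m : ℕ) (E : Finset (Σ _ : ℕ, ℕ)) (f : ℕ → ℕ) : SimpleGraph (Fin n) where
  Adj i j := i ≠ j ∧
    ((i.val % m = j.val % m ∧
        (i.val % m = 0 → f (i.val / m) ≠ j.val / m ∧ f (j.val / m) ≠ i.val / m)) ∨
      (¬ i.val % m = j.val % m ∧ (⟨max i.val j.val, min i.val j.val⟩ : Σ _ : ℕ, ℕ) ∈ E))
  symm := ⟨by
    rintro i j ⟨h1, h2⟩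
    refine ⟨h1.symm, ?_⟩
    rcases h2 with ⟨h2, h3⟩ | ⟨h2, h3⟩
    · exact Or.inl ⟨h2.symm, fun h => (h3 (h2.trans h)).symm⟩
    · refine Or.inr ⟨fun h => h2 h.symm, ?_⟩
      rwa [max_comm, min_comm]⟩
  loopless := ⟨fun i h => h.1 rfl⟩

lemma conG_adj_zero (n m : ℕ) (E : Finset (Σ _ : ℕ, ℕ)) (f : ℕ → ℕ) (i j : Fin n) (hij : i ≠ j)
    (hi : i.val % m = 0) (hj : j.val % m = 0) : (conG n m E f).Adj i j ↔
      f (i.val / m) ≠ j.val / m ∧ f (j.val / m) ≠ i.val / m := by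
  simp [conG, hij, hi, hj]

lemma conG_adj_same (n m : ℕ) (E : Finset (Σ _ : ℕ, ℕ)) (f : ℕ → ℕ) (i j : Fin n) (hij : i ≠ j)
    (c : ℕ) (hc : c ≠ 0) (hi : i.val % m = c) (hj : j.val % m = c) : (conG n m E f).Adj i j := by
  simp [conG, hij, hi, hj, hc]

lemma conG_free (n m : ℕ) (hm : 3 ≤ m) (E : Finset (Σ _ : ℕ, ℕ)) (f : ℕ → ℕ)
    (hf : ∀ x, f (f x) = f x) : IndFree (cycleGraph (2 * (m + 1))) (conG n m E f) := by
  rintro ⟨e⟩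
  have hk : 8 ≤ 2 * (m + 1) := by omega
  have hadj : ∀ x y, (cycleGraph (2 * (m + 1))).Adj x y ↔ (conG n m E f).Adj (e x) (e y) :=
    fun x y => e.map_adj_iff.symm
  have hmaps : ((Finset.univ : Finset (Fin (2 * (m + 1)))) : Set _).MapsTo
      (fun x => (e x).val % m) (Finset.range m) := by
    intro x _
    simpa using Nat.mod_lt _ (by omega)
  have hcard := Finset.card_eq_sum_card_fiberwise hmaps
  have h0 : (Finset.univ.filter fun x => (e x).val % m = 0).card ≤ 3 := by
    apply key _ hk f hf (fun x => (e x).val / m)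
    · intro x hx y hy hxy
      simp only [Finset.mem_filter, Finset.mem_univ, true_and] at hx hy hxy
      apply e.injective
      apply Fin.ext
      rw [← Nat.div_add_mod (e x).val m, ← Nat.div_add_mod (e y).val m, hx, hy, hxy]
    · intro x hx y hy hxy
      simp only [Finset.mem_filter, Finset.mem_univ, true_and] at hx hy
      rw [hadj]
      have : e x ≠ e y := fun h => hxy (e.injective h)
      exact conG_adj_zero n m E f _ _ this hx hy
  have h1 : ∀ c ≠ 0, (Finset.univ.filter fun x => (e x).val % m = c).card ≤ 2 := by
    intro c hc
    by_contra! h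
    obtain ⟨x, y, z, hx, hy, hz, hxy, hxz, hyz⟩ := Finset.two_lt_card_iff.1 h
    simp only [Finset.mem_filter, Finset.mem_univ, true_and] at hx hy hz
    have exy : e x ≠ e y := fun h => hxy (e.injective h)
    have exz : e x ≠ e z := fun h => hxz (e.injective h)
    have eyz : e y ≠ e z := fun h => hyz (e.injective h)
    apply cyc_tri _ hk x y z
    rw [hadj, hadj, hadj]
    exact ⟨conG_adj_same n m E f _ _ exy c hc hx hy, conG_adj_same n m E f _ _ eyz c hc hy hz,
      conG_adj_same n m E f _ _ exz c hc hx hz⟩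
  rw [Finset.card_univ, Fintype.card_fin] at hcard
  obtain ⟨k, rfl⟩ : ∃ k, m = k + 1 := ⟨m - 1, by omega⟩
  rw [Finset.sum_range_succ'] at hcard
  have h2 : ∑ c ∈ Finset.range k,
      (Finset.univ.filter fun x => (e x).val % (k + 1) = c + 1).card ≤ ∑ c ∈ Finset.range k, 2 :=
    Finset.sum_le_sum fun c _ => h1 _ (by omega)
  rw [Finset.sum_const, Finset.card_range, smul_eq_mul] at h2
  omega

lemma conG_inj (n m q : ℕ) (hm : 3 ≤ m) (hq : ∀ x < q, x * m < n)
    (E E' : Finset (Σ _ : ℕ, ℕ)) (hE : E ⊆ pairsD n m) (hE' : E' ⊆ pairsD n m)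
    (P P' : Finpartition (Finset.univ : Finset (Fin q)))
    (h : conG n m E (starFn P) = conG n m E' (starFn P')) : E = E' ∧ P = P' := by
  have hadj : ∀ i j, (conG n m E (starFn P)).Adj i j ↔ (conG n m E' (starFn P')).Adj i j := by
    intro i j
    rw [h]
  constructor
  · ext ⟨j, i⟩
    by_cases hd : (⟨j, i⟩ : Σ _ : ℕ, ℕ) ∈ pairsD n m
    · have hd' := hd
      simp only [pairsD, Finset.mem_sigma, Finset.mem_range, Finset.mem_filter] at hd'
      obtain ⟨hj, hij, hmod⟩ := hd'
      have := hadj ⟨j, hj⟩ ⟨i, by omega⟩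
      have hne : ¬ j % m = i % m := fun h => hmod h.symm
      have hne' : j ≠ i := by omega
      simpa [conG, hne, hne', max_eq_left hij.le, min_eq_right hij.le] using this
    · exact ⟨fun h => absurd (hE h) hd, fun h => absurd (hE' h) hd⟩
  · apply starFn_inj
    have main : ∀ x < q, ∀ y < x, starFn P x = y ↔ starFn P' x = y := by
      intro x hx y hy
      have hyn := hq y (by omega)
      have := hadj ⟨x * m, hq x hx⟩ ⟨y * m, hyn⟩
      have hm0 : 0 < m := by omega
      have hne : x * m ≠ y * m := fun h => by
        have := Nat.eq_of_mul_eq_mul_right hm0 h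
        omega
      have l1 : starFn P y ≠ x := by have := starFn_le P y; omega
      have l2 : starFn P' y ≠ x := by have := starFn_le P' y; omega
      simp only [conG, ne_eq, Fin.mk.injEq, hne, not_false_eq_true, Nat.mul_mod_left,
        Nat.mul_div_cancel _ hm0, l1, l2, true_and, and_true, not_true, false_and, or_false,
        forall_const] at this
      exact not_iff_not.1 this
    intro x hx
    rcases (starFn_le P x).lt_or_eq with h1 | h1
    · exact ((main x hx _ h1).1 rfl).symm
    · rcases (starFn_le P' x).lt_or_eq with h2 | h2
      · exact (main x hx _ h2).2 rfl
      · rw [h1, h2]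

lemma count_bound (n m q : ℕ) (hm : 3 ≤ m) (hq : ∀ x < q, x * m < n) :
    2 ^ (pairsD n m).card * bellNum q ≤
      {G : SimpleGraph (Fin n) | IndFree (cycleGraph (2 * (m + 1))) G}.ncard := by
  have h1 : Nat.card ((pairsD n m).powerset × Finpartition (Finset.univ : Finset (Fin q))) =
      2 ^ (pairsD n m).card * bellNum q := by
    rw [Nat.card_prod, bellNum, Nat.card_eq_fintype_card, Fintype.card_coe, Finset.card_powerset]
  rw [← h1, ← Nat.card_coe_set_eq]
  refine Nat.card_le_card_of_injective
    (fun p => ⟨conG n m p.1.1 (starFn p.2), conG_free n m hm _ _ (starFn_idem p.2)⟩) ?_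
  rintro ⟨⟨E, hE⟩, P⟩ ⟨⟨E', hE'⟩, P'⟩ h
  simp only [Subtype.mk.injEq] at h
  obtain ⟨rfl, rfl⟩ := conG_inj n m q hm hq E E' (Finset.mem_powerset.1 hE)
    (Finset.mem_powerset.1 hE') P P' h
  rfl

/-- For `l > 3`, the number of `C_{2l}`-free graphs on `{1,…,n}` is at least
`2^{(1 - 1/(l-1))·C(n,2)} · B_{⌈n/(l-1)⌉}`. -/
theorem stmt_14 (l : ℕ) (hl : 3 < l) (n : ℕ) (hn : 1 ≤ n) :
    (2 : ℝ) ^ (((1 : ℝ) - 1 / ((l : ℝ) - 1)) * (n.choose 2 : ℝ)) *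
        (bellNum ⌈(n : ℝ) / ((l : ℝ) - 1)⌉₊ : ℝ) ≤
      ({G : SimpleGraph (Fin n) | IndFree (cycleGraph (2 * l)) G}.ncard : ℝ) := by
  obtain ⟨m, rfl⟩ : ∃ m, l = m + 1 := ⟨l - 1, by omega⟩
  have hcast : ((m + 1 : ℕ) : ℝ) - 1 = (m : ℝ) := by push_cast; ring
  rw [hcast]
  have hm0 : (0 : ℝ) < m := by
    have : 0 < m := by omega
    exact_mod_cast this
  have hq : ∀ x < ⌈(n : ℝ) / (m : ℝ)⌉₊, x * m < n := by
    intro x hx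
    rw [Nat.lt_ceil, lt_div_iff₀ hm0] at hx
    exact_mod_cast hx
  have h1 := count_bound n m _ (by omega) hq
  have h2 := card_pairsD n m (by omega)
  have h3 : (2 : ℝ) ^ (((1 : ℝ) - 1 / (m : ℝ)) * (n.choose 2 : ℝ)) ≤
      (2 : ℝ) ^ (pairsD n m).card := by
    rw [← Real.rpow_natCast]
    exact Real.rpow_le_rpow_of_exponent_le (by norm_num) h2
  calc _ ≤ (2 : ℝ) ^ (pairsD n m).card * (bellNum ⌈(n : ℝ) / (m : ℝ)⌉₊ : ℝ) := by gcongr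
    _ ≤ _ := by exact_mod_cast h1
end
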